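/- arXiv:1206.5209 — 2 statements merged into one kernel-verified Lean document; each statement's English description precedes it below -/
import Mathlib

section
/- Dissipation lemma (Lemma 1.5): There exists a constant c0 > 0 such that for every ε ∈ (0,1), every a ≥ 0, every T > 0, every classical solution φ of (S'^a), and all 0 ≤ t1 < t2 ≤ T with t2 − t1 > 1, one has ‖φ(t1,·)‖²_{X¹} ≤ exp( −c0 · max{a^{1/2}, ε^{−1/2}} · ε^{−1/2} · (t2 − t1 − 1)²/(t2 − t1) ) · ‖φ(t2,·)‖²_{X¹}. -/
open Real MeasureTheory intervalIntegral Set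

noncomputable section

/-- A classical solution of the one-dimensional adjoint system `(S'^a)`:
`φ ∈ C^∞`, satisfying `∂_t φ + ∂_x φ + ε ∂_x² φ − a φ = 0` on `Q = (0,T)×(−1,0)`,
the boundary condition `ε(∂_t φ(t,0) − ∂_x φ(t,0)) − φ(t,0) = 0` and
`∂_t φ(t,−1) + ∂_x φ(t,−1) = 0` for `t ∈ (0,T)`. -/
def IsAdjSol1D (T ε a : ℝ) (φ : ℝ → ℝ → ℝ) : Prop :=
  ContDiff ℝ (⊤ : ℕ∞) (fun p : ℝ × ℝ => φ p.1 p.2) ∧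
  (∀ t ∈ Set.Ioo (0:ℝ) T, ∀ x ∈ Set.Ioo (-1:ℝ) 0,
    deriv (fun s => φ s x) t + deriv (fun y => φ t y) x
      + ε * deriv (deriv (fun y => φ t y)) x - a * φ t x = 0) ∧
  (∀ t ∈ Set.Ioo (0:ℝ) T,
    ε * (deriv (fun s => φ s 0) t - deriv (fun y => φ t y) 0) - φ t 0 = 0) ∧
  (∀ t ∈ Set.Ioo (0:ℝ) T,
    deriv (fun s => φ s (-1)) t + deriv (fun y => φ t y) (-1) = 0)

/-- The squared `X¹`-norm: `‖ψ‖²_{X¹} = ∫_{−1}^0 |ψ|² + ε(|ψ(0)|² + |ψ(−1)|²)`. -/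
def X1normSq (ε : ℝ) (ψ : ℝ → ℝ) : ℝ :=
  (∫ x in (-1:ℝ)..0, ψ x ^ 2) + ε * (ψ 0 ^ 2 + ψ (-1) ^ 2)

/-- Differentiation under the integral sign over a compact interval, for an integrand whose
derivative in the parameter is jointly continuous. -/
theorem hasDerivAt_intervalIntegral_of_continuous {F F' : ℝ → ℝ → ℝ} {b c : ℝ}
    (hF : ∀ t, Continuous (F t)) (hF' : Continuous fun q : ℝ × ℝ => F' q.1 q.2)
    (hd : ∀ t x, HasDerivAt (fun s => F s x) (F' t x) t) (t : ℝ) :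
    HasDerivAt (fun s => ∫ x in b..c, F s x) (∫ x in b..c, F' t x) t := by
  obtain ⟨C, hC⟩ := (isCompact_Icc (a := t - 1) (b := t + 1)).prod
    (isCompact_uIcc (a := b) (b := c)) |>.exists_bound_of_continuousOn hF'.continuousOn
  have hslice : Continuous (F' t) := hF'.comp (Continuous.prodMk_right t)
  refine (intervalIntegral.hasDerivAt_integral_of_dominated_loc_of_deriv_le (bound := fun _ => C)
    (Icc_mem_nhds (by linarith : t - 1 < t) (by linarith : t < t + 1))
    (Filter.Eventually.of_forall fun s => (hF s).aestronglyMeasurable)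
    ((hF t).intervalIntegrable _ _) hslice.aestronglyMeasurable ?_
    intervalIntegrable_const ?_).2
  · exact Filter.Eventually.of_forall fun x hx s hs => hC (s, x) ⟨hs, uIoc_subset_uIcc hx⟩
  · exact Filter.Eventually.of_forall fun x _ s _ => hd s x

/-- The `X¹`-energy with exponential weight `exp (p x)`. -/
def weightedEnergy (ε p : ℝ) (ψ : ℝ → ℝ) : ℝ :=
  (∫ x in (-1:ℝ)..0, exp (p * x) * ψ x ^ 2) + ε * (ψ 0 ^ 2 + exp (-p) * ψ (-1) ^ 2)

theorem weightedEnergy_zero (ε : ℝ) (ψ : ℝ → ℝ) : weightedEnergy ε 0 ψ = X1normSq ε ψ := by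
  simp [weightedEnergy, X1normSq]

theorem weightedEnergy_le_X1normSq {ε p : ℝ} {ψ : ℝ → ℝ} (hε : 0 ≤ ε) (hp : 0 ≤ p)
    (hψ : Continuous ψ) : weightedEnergy ε p ψ ≤ X1normSq ε ψ := by
  have h1 : (∫ x in (-1:ℝ)..0, exp (p * x) * ψ x ^ 2) ≤ ∫ x in (-1:ℝ)..0, ψ x ^ 2 := by
    refine intervalIntegral.integral_mono_on (by norm_num)
      (Continuous.intervalIntegrable (by fun_prop) _ _)
      (Continuous.intervalIntegrable (by fun_prop) _ _) fun x hx => ?_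
    exact mul_le_of_le_one_left (sq_nonneg _)
      (exp_le_one_iff.2 (mul_nonpos_of_nonneg_of_nonpos hp hx.2))
  have h2 : exp (-p) * ψ (-1) ^ 2 ≤ ψ (-1) ^ 2 :=
    mul_le_of_le_one_left (sq_nonneg _) (exp_le_one_iff.2 (by linarith))
  unfold weightedEnergy X1normSq
  gcongr

theorem exp_neg_mul_X1normSq_le_weightedEnergy {ε p : ℝ} {ψ : ℝ → ℝ} (hε : 0 ≤ ε) (hp : 0 ≤ p)
    (hψ : Continuous ψ) : exp (-p) * X1normSq ε ψ ≤ weightedEnergy ε p ψ := by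
  have h1 : exp (-p) * (∫ x in (-1:ℝ)..0, ψ x ^ 2) ≤
      ∫ x in (-1:ℝ)..0, exp (p * x) * ψ x ^ 2 := by
    rw [← intervalIntegral.integral_const_mul]
    refine intervalIntegral.integral_mono_on (by norm_num)
      (Continuous.intervalIntegrable (by fun_prop) _ _)
      (Continuous.intervalIntegrable (by fun_prop) _ _) fun x hx => ?_
    have : -p ≤ p * x := by nlinarith [hx.1]
    gcongr
  have h2 : exp (-p) * ψ 0 ^ 2 ≤ ψ 0 ^ 2 :=
    mul_le_of_le_one_left (sq_nonneg _) (exp_le_one_iff.2 (by linarith))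
  unfold weightedEnergy X1normSq
  nlinarith [mul_le_mul_of_nonneg_left h2 hε]

theorem contDiff_slice {φ : ℝ → ℝ → ℝ}
    (hφ : ContDiff ℝ (⊤ : ℕ∞) fun q : ℝ × ℝ => φ q.1 q.2) (t : ℝ) :
    ContDiff ℝ (⊤ : ℕ∞) (φ t) :=
  hφ.comp (contDiff_const.prodMk contDiff_id)

theorem hasDerivAt_time {φ : ℝ → ℝ → ℝ}
    (hφ : ContDiff ℝ (⊤ : ℕ∞) fun q : ℝ × ℝ => φ q.1 q.2) (t x : ℝ) :
    HasDerivAt (fun s => φ s x) (deriv (fun s => φ s x) t) t :=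
  ((hφ.comp (contDiff_id.prodMk contDiff_const)).differentiable (by simp) t).hasDerivAt

theorem continuous_deriv_time {φ : ℝ → ℝ → ℝ}
    (hφ : ContDiff ℝ (⊤ : ℕ∞) fun q : ℝ × ℝ => φ q.1 q.2) :
    Continuous fun q : ℝ × ℝ => deriv (fun s => φ s q.2) q.1 := by
  have h : (fun q : ℝ × ℝ => deriv (fun s => φ s q.2) q.1) =
      fun q => fderiv ℝ (fun q : ℝ × ℝ => φ q.1 q.2) q (1, 0) := by
    funext q
    have h1 := (hφ.differentiable (by simp) q).hasFDerivAt
    exact (h1.comp_hasDerivAt (f := fun s : ℝ => (s, q.2)) q.1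
      ((hasDerivAt_id q.1).prodMk (hasDerivAt_const q.1 q.2))).deriv
  rw [h]
  exact (hφ.continuous_fderiv (by simp)).clm_apply continuous_const

theorem hasDerivAt_weightedEnergy {φ : ℝ → ℝ → ℝ}
    (hφ : ContDiff ℝ (⊤ : ℕ∞) fun q : ℝ × ℝ => φ q.1 q.2) (ε p t : ℝ) :
    HasDerivAt (fun s => weightedEnergy ε p (φ s))
      ((∫ x in (-1:ℝ)..0, exp (p * x) * (2 * φ t x * deriv (fun s => φ s x) t)) +
        ε * (2 * φ t 0 * deriv (fun s => φ s 0) t +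
          exp (-p) * (2 * φ t (-1) * deriv (fun s => φ s (-1)) t))) t := by
  have hsq : ∀ t x, HasDerivAt (fun s => φ s x ^ 2) (2 * φ t x * deriv (fun s => φ s x) t) t := by
    intro t x
    simpa using (hasDerivAt_time hφ t x).fun_pow 2
  refine HasDerivAt.add ?_ (((hsq t 0).add ((hsq t (-1)).const_mul _)).const_mul ε)
  refine hasDerivAt_intervalIntegral_of_continuous
    (F' := fun t x => exp (p * x) * (2 * φ t x * deriv (fun s => φ s x) t)) (fun s => ?_) ?_
    (fun s x => (hsq s x).const_mul _) t
  · have := (contDiff_slice hφ s).continuous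
    fun_prop
  · have := hφ.continuous
    have := continuous_deriv_time hφ
    fun_prop

/-- Growth of the weighted energy, under an algebraic coercivity condition on the weight `p`,
the multiplier `μ` of the boundary trace, and the rate `r`. -/
theorem mul_weightedEnergy_le_deriv {T ε a : ℝ} {φ : ℝ → ℝ → ℝ} (hsol : IsAdjSol1D T ε a φ)
    {p μ r : ℝ} (hε : 0 < ε) (hp : 0 ≤ p) (hbd : r * ε ≤ 1 + μ - ε * p)
    (hint : ∀ x ∈ Ioo (-1:ℝ) 0, ∀ u v : ℝ,
      r * u ^ 2 + μ * (2 + p * (2 * x + 1)) * u ^ 2 + 2 * μ * (2 * x + 1) * (u * v) ≤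
        2 * a * u ^ 2 + 2 * ε * v ^ 2 + (p - ε * p ^ 2) * u ^ 2)
    {t : ℝ} (ht : t ∈ Ioo 0 T) :
    r * weightedEnergy ε p (φ t) ≤ deriv (fun s => weightedEnergy ε p (φ s)) t := by
  obtain ⟨hφ, hpde, hright, hleft⟩ := hsol
  rw [(hasDerivAt_weightedEnergy hφ ε p t).deriv]
  have hs := contDiff_slice hφ t
  have hcu := hs.continuous
  have hdu : ∀ x, HasDerivAt (φ t) (deriv (φ t) x) x := fun x =>
    (hs.differentiable (by simp) x).hasDerivAt
  have hs' : ContDiff ℝ (⊤ : ℕ∞) (deriv (φ t)) := (contDiff_infty_iff_deriv.1 hs).2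
  have hcv := hs'.continuous
  have hdv : ∀ x, HasDerivAt (deriv (φ t)) (deriv (deriv (φ t)) x) x := fun x =>
    (hs'.differentiable (by simp) x).hasDerivAt
  have hct : Continuous fun x => deriv (fun s => φ s x) t :=
    (continuous_deriv_time hφ).comp (Continuous.prodMk_right t)
  let H : ℝ → ℝ := fun x => exp (p * x) *
    ((ε * p - 1 + μ * (2 * x + 1)) * φ t x ^ 2 - 2 * ε * (φ t x * deriv (φ t) x))
  have hH : ∀ x, HasDerivAt H (exp (p * x) * (p *
      ((ε * p - 1 + μ * (2 * x + 1)) * φ t x ^ 2 - 2 * ε * (φ t x * deriv (φ t) x)) +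
      (2 * μ * φ t x ^ 2 + (ε * p - 1 + μ * (2 * x + 1)) * (2 * φ t x * deriv (φ t) x) -
        2 * ε * (deriv (φ t) x ^ 2 + φ t x * deriv (deriv (φ t)) x)))) x := by
    intro x
    have he : HasDerivAt (fun x => exp (p * x)) (exp (p * x) * (p * 1)) x :=
      ((hasDerivAt_id x).const_mul p).exp
    have hm : HasDerivAt (fun x : ℝ => ε * p - 1 + μ * (2 * x + 1)) (μ * (2 * 1)) x :=
      ((((hasDerivAt_id x).const_mul 2).add_const 1).const_mul μ).const_add _
    convert! he.mul ((hm.mul ((hdu x).pow 2)).sub (((hdu x).mul (hdv x)).const_mul (2 * ε))) using 1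
    simp
    ring
  have key : H 0 - H (-1) ≤ ∫ x in (-1:ℝ)..0,
      (exp (p * x) * (2 * φ t x * deriv (fun s => φ s x) t) - r * (exp (p * x) * φ t x ^ 2)) := by
    refine sub_le_integral_of_hasDeriv_right_of_le (by norm_num)
      (fun x _ => (hH x).continuousAt.continuousWithinAt)
      (fun x _ => (hH x).hasDerivWithinAt)
      (Continuous.integrableOn_Icc (by fun_prop)) fun x hx => ?_
    have h1 : deriv (fun s => φ s x) t = a * φ t x - deriv (φ t) x
        - ε * deriv (deriv (φ t)) x := by
      linarith [hpde t ht x hx]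
    have h2 := hint x hx (φ t x) (deriv (φ t) x)
    rw [h1]
    have h3 := mul_le_mul_of_nonneg_left h2 (exp_pos (p * x)).le
    linarith
  rw [intervalIntegral.integral_sub (Continuous.intervalIntegrable (by fun_prop) _ _)
    (Continuous.intervalIntegrable (by fun_prop) _ _), intervalIntegral.integral_const_mul] at key
  have h0 : ε * deriv (fun s => φ s 0) t = ε * deriv (φ t) 0 + φ t 0 := by
    linarith [hright t ht]
  have h1 : deriv (fun s => φ s (-1)) t = - deriv (φ t) (-1) := by
    linarith [hleft t ht]
  have hε0 : ε * (2 * φ t 0 * deriv (fun s => φ s 0) t) =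
      2 * φ t 0 * (ε * deriv (φ t) 0 + φ t 0) := by
    rw [← h0]; ring
  have hb0 : 0 ≤ (1 + μ + ε * p - r * ε) * φ t 0 ^ 2 :=
    mul_nonneg (by nlinarith [mul_nonneg hε.le hp]) (sq_nonneg _)
  have hb1 : 0 ≤ exp (-p) * ((1 + μ - ε * p - r * ε) * φ t (-1) ^ 2) :=
    mul_nonneg (exp_pos _).le (mul_nonneg (by linarith) (sq_nonneg _))
  simp only [H, mul_zero, exp_zero, mul_neg, mul_one] at key
  rw [mul_add ε, hε0, h1]
  unfold weightedEnergy
  linarith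

theorem weightedEnergy_le_exp_mul {T ε a : ℝ} {φ : ℝ → ℝ → ℝ} (hsol : IsAdjSol1D T ε a φ)
    {p μ r : ℝ} (hε : 0 < ε) (hp : 0 ≤ p) (hbd : r * ε ≤ 1 + μ - ε * p)
    (hint : ∀ x ∈ Ioo (-1:ℝ) 0, ∀ u v : ℝ,
      r * u ^ 2 + μ * (2 + p * (2 * x + 1)) * u ^ 2 + 2 * μ * (2 * x + 1) * (u * v) ≤
        2 * a * u ^ 2 + 2 * ε * v ^ 2 + (p - ε * p ^ 2) * u ^ 2)
    {t1 t2 : ℝ} (h1 : 0 ≤ t1) (h12 : t1 ≤ t2) (h2 : t2 ≤ T) :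
    weightedEnergy ε p (φ t1) ≤ exp (-(r * (t2 - t1))) * weightedEnergy ε p (φ t2) := by
  have hd : ∀ t, HasDerivAt (fun s => weightedEnergy ε p (φ s))
      (deriv (fun s => weightedEnergy ε p (φ s)) t) t := fun t =>
    (hasDerivAt_weightedEnergy hsol.1 ε p t).differentiableAt.hasDerivAt
  have hG : ∀ t, HasDerivAt (fun s => exp (-(r * s)) * weightedEnergy ε p (φ s))
      (exp (-(r * t)) * (-(r * 1)) * weightedEnergy ε p (φ t) +
        exp (-(r * t)) * deriv (fun s => weightedEnergy ε p (φ s)) t) t := fun t =>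
    ((hasDerivAt_id t).const_mul r).neg.exp.mul (hd t)
  have hmono : MonotoneOn (fun s => exp (-(r * s)) * weightedEnergy ε p (φ s)) (Icc t1 t2) := by
    refine monotoneOn_of_deriv_nonneg (convex_Icc _ _)
      (fun t _ => (hG t).continuousAt.continuousWithinAt)
      (fun t _ => (hG t).differentiableAt.differentiableWithinAt) fun t ht => ?_
    rw [interior_Icc] at ht
    rw [(hG t).deriv]
    have := mul_weightedEnergy_le_deriv hsol hε hp hbd hint
      ⟨h1.trans_lt ht.1, ht.2.trans_le h2⟩
    nlinarith [mul_le_mul_of_nonneg_left this (exp_pos (-(r * t))).le]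
  have h := hmono (left_mem_Icc.2 h12) (right_mem_Icc.2 h12) h12
  have h' := mul_le_mul_of_nonneg_left h (exp_pos (r * t1)).le
  simp only [← mul_assoc, ← exp_add] at h'
  rw [add_neg_cancel, exp_zero, one_mul] at h'
  rwa [show r * t1 + -(r * t2) = -(r * (t2 - t1)) by ring] at h'

theorem X1normSq_nonneg {ε : ℝ} (hε : 0 ≤ ε) (ψ : ℝ → ℝ) : 0 ≤ X1normSq ε ψ :=
  add_nonneg (intervalIntegral.integral_nonneg (by norm_num) fun _ _ => sq_nonneg _)
    (by positivity)

/-- Decay produced by transport, diffusion and the boundary conditions alone. -/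
theorem X1normSq_le_of_transport {T ε a : ℝ} {φ : ℝ → ℝ → ℝ} (hsol : IsAdjSol1D T ε a φ)
    (hε : 0 < ε) (ha : 0 ≤ a) {t1 t2 : ℝ} (h1 : 0 ≤ t1) (h2 : t2 ≤ T) (h : 1 < t2 - t1) :
    X1normSq ε (φ t1) ≤
      exp (-(ε⁻¹ * ((t2 - t1 - 1) ^ 2 / (4 * (t2 - t1))))) * X1normSq ε (φ t2) := by
  set τ := t2 - t1 with hτ
  have hτ0 : 0 < τ := by linarith
  set k := (τ - 1) / (2 * τ) with hk
  have hk0 : 0 ≤ k := div_nonneg (by linarith) (by linarith)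
  have hk1 : k ≤ 1 := by rw [hk, div_le_one (by linarith)]; linarith
  have hp : 0 ≤ k / ε := by positivity
  have hkε : ε * (k / ε) = k := by field_simp
  have hdecay := weightedEnergy_le_exp_mul hsol (p := k / ε) (μ := 0) (r := k * (1 - k) / ε) hε hp
    (by rw [hkε, div_mul_cancel₀ _ hε.ne']; nlinarith)
    (fun x _ u v => by
      have : k / ε - ε * (k / ε) ^ 2 = k * (1 - k) / ε := by field_simp
      rw [this]
      nlinarith [mul_nonneg ha (sq_nonneg u), mul_nonneg hε.le (sq_nonneg v)])
    h1 (by linarith) h2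
  have hlo := exp_neg_mul_X1normSq_le_weightedEnergy hε.le hp (contDiff_slice hsol.1 t1).continuous
  have hhi := weightedEnergy_le_X1normSq hε.le hp (contDiff_slice hsol.1 t2).continuous
  have hchain := hlo.trans (hdecay.trans (mul_le_mul_of_nonneg_left hhi (exp_pos _).le))
  have h' := mul_le_mul_of_nonneg_left hchain (exp_pos (k / ε)).le
  simp only [← mul_assoc, ← exp_add] at h'
  rw [add_neg_cancel, exp_zero, one_mul] at h'
  have hexp : k / ε + -(k * (1 - k) / ε * (t2 - t1)) = -(ε⁻¹ * ((τ - 1) ^ 2 / (4 * τ))) := by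
    rw [← hτ, hk]
    field_simp
    ring
  rwa [hexp] at h'

/-- Decay produced by a zeroth-order term dominating the inverse viscosity. -/
theorem X1normSq_le_of_damping {T ε a : ℝ} {φ : ℝ → ℝ → ℝ} (hsol : IsAdjSol1D T ε a φ)
    (hε : 0 < ε) (hε1 : ε < 1) (ha : 0 ≤ a) (haε : (√ε)⁻¹ ≤ √a) {t1 t2 : ℝ} (h1 : 0 ≤ t1)
    (h12 : t1 ≤ t2) (h2 : t2 ≤ T) :
    X1normSq ε (φ t1) ≤ exp (-(√a * (√ε)⁻¹ / 4 * (t2 - t1))) * X1normSq ε (φ t2) := by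
  obtain ⟨e, he, rfl⟩ : ∃ e : ℝ, 0 < e ∧ e ^ 2 = ε := ⟨√ε, sqrt_pos.2 hε, sq_sqrt hε.le⟩
  obtain ⟨b, hb, rfl⟩ : ∃ b : ℝ, 0 ≤ b ∧ b ^ 2 = a := ⟨√a, sqrt_nonneg a, sq_sqrt ha⟩
  rw [sqrt_sq he.le, sqrt_sq hb] at *
  have he1 : e < 1 := by nlinarith
  have hmul : b * e⁻¹ ≤ b ^ 2 := by rw [sq]; gcongr
  have hbe : b * e ≤ b ^ 2 := by
    have : e ≤ e⁻¹ := he1.le.trans (one_le_inv_iff₀.2 ⟨he, he1.le⟩)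
    exact (mul_le_mul_of_nonneg_left this hb).trans hmul
  have hcancel : b * e⁻¹ / 4 * e ^ 2 = b * e / 4 := by field_simp
  have := weightedEnergy_le_exp_mul hsol (p := 0) (μ := b * e / 4) (r := b * e⁻¹ / 4) hε le_rfl
    (by rw [hcancel]; linarith)
    (fun x hx u v => by
      have hx2 : (2 * x + 1) ^ 2 ≤ 1 := by nlinarith [hx.1, hx.2]
      have hsq := sq_nonneg (b * u - (2 * x + 1) * (e * v))
      have h3 : (2 * x + 1) ^ 2 * (e * v) ^ 2 ≤ 1 * (e * v) ^ 2 := by gcongr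
      have h4 := mul_le_mul_of_nonneg_right hmul (sq_nonneg u)
      have h5 := mul_le_mul_of_nonneg_right hbe (sq_nonneg u)
      nlinarith [sq_nonneg (b * u), sq_nonneg (e * v)])
    h1 h12 h2
  simpa only [weightedEnergy_zero] using this

/-- Dissipation lemma (Lemma 1.5). -/
theorem dissipation_lemma :
    ∃ c0 > (0:ℝ), ∀ ε ∈ Set.Ioo (0:ℝ) 1, ∀ a ≥ (0:ℝ), ∀ T > (0:ℝ),
      ∀ φ : ℝ → ℝ → ℝ, IsAdjSol1D T ε a φ →
      ∀ t1 t2 : ℝ, 0 ≤ t1 → t1 < t2 → t2 ≤ T → 1 < t2 - t1 →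
        X1normSq ε (φ t1) ≤
          Real.exp (-c0 * (max (Real.sqrt a) (Real.sqrt ε)⁻¹) * (Real.sqrt ε)⁻¹ *
              ((t2 - t1 - 1) ^ 2 / (t2 - t1))) * X1normSq ε (φ t2) := by
  refine ⟨1 / 4, by norm_num, ?_⟩
  rintro ε ⟨hε, hε1⟩ a ha T _ φ hsol t1 t2 h1 h12 h2 h
  have hτ : 0 < t2 - t1 := by linarith
  rcases le_total (√a) (√ε)⁻¹ with haε | haε
  · rw [max_eq_right haε]
    have hexp : -(1 / 4) * (√ε)⁻¹ * (√ε)⁻¹ * ((t2 - t1 - 1) ^ 2 / (t2 - t1)) =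
        -(ε⁻¹ * ((t2 - t1 - 1) ^ 2 / (4 * (t2 - t1)))) := by
      rw [mul_assoc (-(1 / 4)), ← mul_inv, mul_self_sqrt hε.le]
      field_simp
    rw [hexp]
    exact X1normSq_le_of_transport hsol hε ha h1 h2 h
  · rw [max_eq_left haε]
    refine (X1normSq_le_of_damping hsol hε hε1 ha haε h1 h12.le h2).trans ?_
    refine mul_le_mul_of_nonneg_right (exp_le_exp.2 ?_) (X1normSq_nonneg hε.le _)
    have hq : (t2 - t1 - 1) ^ 2 / (t2 - t1) ≤ t2 - t1 := by
      rw [div_le_iff₀ hτ]; nlinarith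
    have hr : 0 ≤ √a * (√ε)⁻¹ / 4 := by positivity
    linarith [mul_le_mul_of_nonneg_left hq hr]
end
end

section
/- Monotonicity of the X¹-energy for the one-dimensional adjoint system: For every T > 0, ε > 0, a ≥ 0, every classical solution φ of (S'^a), and all 0 ≤ t1 ≤ t2 ≤ T, one has ‖φ(t1,·)‖_{X¹} ≤ ‖φ(t2,·)‖_{X¹}. (In particular ‖φ(t,·)‖_{X¹} ≤ ‖φ(T,·)‖_{X¹} for all t ∈ [0,T].) -/
open Real MeasureTheory intervalIntegral Set

noncomputable section

/-- Differentiation under the integral sign over a compact interval, for a jointly continuous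
partial derivative. -/
theorem hasDerivAt_intervalIntegral_of_continuous_s9 {f f' : ℝ → ℝ → ℝ} {a b : ℝ}
    (hf : ∀ t, Continuous (f t)) (hf' : Continuous fun p : ℝ × ℝ => f' p.1 p.2)
    (hd : ∀ t x, HasDerivAt (fun s => f s x) (f' t x) t) (t : ℝ) :
    HasDerivAt (fun s => ∫ x in a..b, f s x) (∫ x in a..b, f' t x) t := by
  obtain ⟨C, hC⟩ := ((isCompact_Icc (a := t - 1) (b := t + 1)).prod
    (isCompact_uIcc (a := a) (b := b))).exists_bound_of_continuousOn hf'.continuousOn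
  have hf't : Continuous (f' t) := hf'.comp (Continuous.prodMk_right t)
  exact (intervalIntegral.hasDerivAt_integral_of_dominated_loc_of_deriv_le
    (bound := fun _ => C) (Icc_mem_nhds (by linarith) (by linarith))
    (Filter.Eventually.of_forall fun s => (hf s).aestronglyMeasurable)
    ((hf t).intervalIntegrable _ _) hf't.aestronglyMeasurable
    (Filter.Eventually.of_forall fun x hx s hs => hC (s, x) ⟨hs, uIoc_subset_uIcc hx⟩)
    intervalIntegrable_const
    (Filter.Eventually.of_forall fun x _ s _ => hd s x)).2

theorem hasDerivAt_left_of_contDiff {φ : ℝ → ℝ → ℝ}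
    (hφ : ContDiff ℝ 1 fun p : ℝ × ℝ => φ p.1 p.2) (t x : ℝ) :
    HasDerivAt (fun s => φ s x) (fderiv ℝ (fun p : ℝ × ℝ => φ p.1 p.2) (t, x) (1, 0)) t :=
  HasFDerivAt.comp_hasDerivAt (f := fun s : ℝ => (s, x)) t
    (hφ.differentiable one_ne_zero (t, x)).hasFDerivAt
    ((hasDerivAt_id t).prodMk (hasDerivAt_const t x))

theorem continuous_deriv_left_of_contDiff {φ : ℝ → ℝ → ℝ}
    (hφ : ContDiff ℝ 1 fun p : ℝ × ℝ => φ p.1 p.2) :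
    Continuous fun p : ℝ × ℝ => deriv (fun s => φ s p.2) p.1 := by
  simp only [fun p : ℝ × ℝ => (hasDerivAt_left_of_contDiff hφ p.1 p.2).deriv]
  exact (hφ.continuous_fderiv one_ne_zero).clm_apply continuous_const

/-- The `X¹`-energy of a `C¹` function may be differentiated under the integral sign. -/
theorem hasDerivAt_X1normSq {φ : ℝ → ℝ → ℝ}
    (hφ : ContDiff ℝ 1 fun p : ℝ × ℝ => φ p.1 p.2) (ε t : ℝ) :
    HasDerivAt (fun s => X1normSq ε (φ s))
      ((∫ x in (-1:ℝ)..0, 2 * (φ t x * deriv (fun s => φ s x) t))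
        + ε * (2 * (φ t 0 * deriv (fun s => φ s 0) t)
          + 2 * (φ t (-1) * deriv (fun s => φ s (-1)) t))) t := by
  have hsq (t x : ℝ) :
      HasDerivAt (fun s => φ s x ^ 2) (2 * (φ t x * deriv (fun s => φ s x) t)) t := by
    have h := (hasDerivAt_left_of_contDiff hφ t x).differentiableAt.hasDerivAt.fun_pow 2
    refine h.congr_deriv ?_
    push_cast
    ring
  have hcont (t : ℝ) : Continuous (φ t) := hφ.continuous.comp (Continuous.prodMk_right t)
  refine (hasDerivAt_intervalIntegral_of_continuous_s9 (fun t => (hcont t).pow 2) ?_ hsq t).add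
    (((hsq t 0).add (hsq t (-1))).const_mul ε)
  exact continuous_const.mul (hφ.continuous.mul (continuous_deriv_left_of_contDiff hφ))

/-- Multiplying the equation by `u` and integrating by parts: if `v + u' + ε u'' = a u` on `(-1,0)`
with `ε, a ≥ 0`, then `∫ u v` is bounded below by the boundary terms. -/
theorem boundary_terms_le_integral {ε a : ℝ} (hε : 0 ≤ ε) (ha : 0 ≤ a) {u v : ℝ → ℝ}
    (hu : ContDiff ℝ 2 u) (hv : Continuous v)
    (h : ∀ x ∈ Ioo (-1:ℝ) 0, v x + deriv u x + ε * deriv (deriv u) x - a * u x = 0) :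
    (-(u 0 ^ 2) - 2 * ε * (u 0 * deriv u 0))
        - (-(u (-1) ^ 2) - 2 * ε * (u (-1) * deriv u (-1)))
      ≤ ∫ x in (-1:ℝ)..0, 2 * (u x * v x) := by
  have hu' : ContDiff ℝ 1 (deriv u) := hu.deriv'
  have hu'' : Continuous (deriv (deriv u)) := hu'.continuous_deriv_one
  have hd (x : ℝ) : HasDerivAt (fun y => -(u y ^ 2) - 2 * ε * (u y * deriv u y))
      (-(2 * u x * deriv u x) - 2 * ε * (deriv u x ^ 2 + u x * deriv (deriv u) x)) x := by
    have h₁ := (hu.differentiable two_ne_zero x).hasDerivAt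
    have h₂ := (hu'.differentiable one_ne_zero x).hasDerivAt
    refine ((h₁.fun_pow 2).fun_neg.fun_sub ((h₁.fun_mul h₂).const_mul (2 * ε))).congr_deriv ?_
    push_cast
    ring
  have hc := hu.continuous
  have hc' := hu'.continuous
  have hint : Continuous fun x =>
      -(2 * u x * deriv u x) - 2 * ε * (deriv u x ^ 2 + u x * deriv (deriv u) x) := by
    fun_prop
  rw [← intervalIntegral.integral_eq_sub_of_hasDerivAt (fun x _ => hd x)
    (hint.intervalIntegrable _ _)]
  refine intervalIntegral.integral_mono_on_of_le_Ioo (by norm_num)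
    (hint.intervalIntegrable _ _)
    ((continuous_const.mul (hc.mul hv)).intervalIntegrable _ _) fun x hx => ?_
  have hvx : v x = a * u x - deriv u x - ε * deriv (deriv u) x := by linarith [h x hx]
  rw [hvx]
  nlinarith [mul_nonneg ha (sq_nonneg (u x)), mul_nonneg hε (sq_nonneg (deriv u x))]

/-- Monotonicity of the `X¹`-energy for the one-dimensional adjoint system. -/
theorem X1_energy_monotone :
    ∀ T > (0:ℝ), ∀ ε > (0:ℝ), ∀ a ≥ (0:ℝ),
      ∀ φ : ℝ → ℝ → ℝ, IsAdjSol1D T ε a φ →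
      ∀ t1 t2 : ℝ, 0 ≤ t1 → t1 ≤ t2 → t2 ≤ T →
        Real.sqrt (X1normSq ε (φ t1)) ≤ Real.sqrt (X1normSq ε (φ t2)) := by
  intro T _ ε hε a ha φ ⟨hφ, hpde, hbc₀, hbc₁⟩ t1 t2 h1 h12 h2
  have hφ1 : ContDiff ℝ 1 fun p : ℝ × ℝ => φ p.1 p.2 := hφ.of_le (by exact_mod_cast le_top)
  have hderiv := hasDerivAt_X1normSq hφ1 ε
  have hmono : MonotoneOn (fun s => X1normSq ε (φ s)) (Icc 0 T) := by
    refine monotoneOn_of_deriv_nonneg (convex_Icc 0 T)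
      (fun t _ => (hderiv t).continuousAt.continuousWithinAt)
      (fun t _ => (hderiv t).differentiableAt.differentiableWithinAt) fun t ht => ?_
    rw [interior_Icc] at ht
    rw [(hderiv t).deriv]
    have hu : ContDiff ℝ 2 (φ t) :=
      (hφ.of_le (WithTop.coe_le_coe.2 (le_top : (2 : ℕ∞) ≤ ⊤))).comp (contDiff_prodMk_right t)
    have hv : Continuous fun x => deriv (fun s => φ s x) t :=
      (continuous_deriv_left_of_contDiff hφ1).comp (Continuous.prodMk_right t)
    have hI := boundary_terms_le_integral hε.le ha hu hv (hpde t ht)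
    have e₀ : ε * deriv (fun s => φ s 0) t = ε * deriv (φ t) 0 + φ t 0 := by
      linarith [hbc₀ t ht]
    have e₁ : deriv (fun s => φ s (-1)) t = -deriv (φ t) (-1) := by linarith [hbc₁ t ht]
    have e₂ : ε * (2 * (φ t 0 * deriv (fun s => φ s 0) t)
          + 2 * (φ t (-1) * deriv (fun s => φ s (-1)) t))
        = 2 * φ t 0 * (ε * deriv (φ t) 0 + φ t 0)
          - 2 * ε * (φ t (-1) * deriv (φ t) (-1)) := by
      rw [← e₀, e₁]
      ring
    rw [e₂]
    nlinarith [sq_nonneg (φ t 0), sq_nonneg (φ t (-1))]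
  exact Real.sqrt_le_sqrt (hmono ⟨h1, h12.trans h2⟩ ⟨h1.trans h12, h2⟩ h12)
end
end
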